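/- arXiv:math/0605361 — 2 statements merged into one kernel-verified Lean document; each statement's English description precedes it below -/
import Mathlib

section
/- Let α, β, θ, μ > 0 with J = θ − β²/(4α), fix y₁ ∈ ℝ and y₂ ∈ ℝ with A := μ − y₂/2 ≠ 0, and let g₁(s) = y₁·exp( (μ − J/2)s + ((y₂ − J)/(2α))·(e^{−αs} − 1) ). Then there exist constants C > 0 and δ > 0 such that for all s ∈ [0, δ], | ∫₀ˢ g₁(u) du − y₁·(e^{As} − 1)/A | ≤ C·s³. -/
/-- The approximation `g₃(s) = y₃ + y₁(e^{As} − 1)/A` of the third coordinate of the flow of the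
Heston Stratonovich drift has error `O(s³)`: `|∫₀ˢ g₁(u)du − y₁(e^{As} − 1)/A| ≤ C s³`. -/
theorem heston_third_coordinate_approx (α β θ μ : ℝ)
    (hα : 0 < α) (hβ : 0 < β) (hθ : 0 < θ) (hμ : 0 < μ)
    (J : ℝ) (hJ : J = θ - β ^ 2 / (4 * α)) (y₁ y₂ : ℝ)
    (A : ℝ) (hA : A = μ - y₂ / 2) (hA0 : A ≠ 0)
    (g₁ : ℝ → ℝ)
    (hg₁ : ∀ s : ℝ, g₁ s =
      y₁ * Real.exp ((μ - J / 2) * s + (y₂ - J) / (2 * α) * (Real.exp (-α * s) - 1))) :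
    ∃ C > (0 : ℝ), ∃ δ > (0 : ℝ), ∀ s ∈ Set.Icc (0 : ℝ) δ,
      |(∫ u in (0 : ℝ)..s, g₁ u) - y₁ * (Real.exp (A * s) - 1) / A| ≤ C * s ^ 3 := by
  obtain ⟨K, hK⟩ : ∃ K, K = (y₂ - J) / (2 * α) := ⟨_, rfl⟩
  have hKα : K * α = (y₂ - J) / 2 := by rw [hK]; field_simp
  have hd : 0 < α * (1 + |K|) := by positivity
  obtain ⟨δ, hδ⟩ : ∃ δ, δ = 1 / (α * (1 + |K|)) := ⟨_, rfl⟩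
  have hδ0 : 0 < δ := by rw [hδ]; positivity
  have hδ1 : (1 + |K|) * (α * δ) = 1 := by rw [hδ]; field_simp
  obtain ⟨M, hM⟩ : ∃ M, M = |y₁| * (Real.exp (|A| * δ) * (2 * (|K| * α ^ 2))) := ⟨_, rfl⟩
  have hM0 : 0 ≤ M := by rw [hM]; positivity
  have key : ∀ u, 0 ≤ u → u ≤ δ → |g₁ u - y₁ * Real.exp (A * u)| ≤ M * u ^ 2 := by
    intro u hu0 huδ
    have hαu0 : 0 ≤ α * u := by positivity
    have hαδ : α * u ≤ α * δ := by gcongr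
    have h1 : (1 + |K|) * (α * u) ≤ 1 := le_trans (by gcongr) hδ1.le
    have hKu : 0 ≤ |K| * (α * u) := by positivity
    have hαu1 : α * u ≤ 1 := by linarith
    have hq := Real.abs_exp_sub_one_sub_id_le (x := -α * u)
      (by rw [abs_le]; constructor <;> linarith)
    obtain ⟨r, hr⟩ : ∃ r, r = K * (Real.exp (-α * u) - 1 - -α * u) := ⟨_, rfl⟩
    have hr2 : |r| ≤ |K| * α ^ 2 * u ^ 2 := by
      rw [hr, abs_mul]
      calc _ ≤ |K| * (-α * u) ^ 2 := by gcongr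
        _ = _ := by ring
    have hr1 : |r| ≤ 1 := by
      refine hr2.trans ?_
      nlinarith
    have he := Real.abs_exp_sub_one_le hr1
    have hg : g₁ u - y₁ * Real.exp (A * u) = y₁ * (Real.exp (A * u) * (Real.exp r - 1)) := by
      have : (μ - J / 2) * u + (y₂ - J) / (2 * α) * (Real.exp (-α * u) - 1) = A * u + r := by
        rw [← hK, hr, hA]
        linear_combination -u * hKα
      rw [hg₁, this, Real.exp_add]; ring
    rw [hg, abs_mul, abs_mul, Real.abs_exp, hM]
    have hA1 : A * u ≤ |A| * δ :=
      (mul_le_mul_of_nonneg_right (le_abs_self A) hu0).trans (by gcongr)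
    calc _ ≤ |y₁| * (Real.exp (|A| * δ) * (2 * (|K| * α ^ 2 * u ^ 2))) := by
          gcongr
          linarith
      _ = _ := by ring
  have hgc : Continuous g₁ := by
    rw [funext hg₁]; fun_prop
  refine ⟨M + 1, by linarith, δ, hδ0, ?_⟩
  rintro s ⟨hs0, hsδ⟩
  have hint : ∫ u in (0 : ℝ)..s, y₁ * Real.exp (A * u) = y₁ * (Real.exp (A * s) - 1) / A := by
    rw [intervalIntegral.integral_const_mul, intervalIntegral.integral_comp_mul_left _ hA0,
      integral_exp]
    simp
    field_simp
  rw [← hint, ← intervalIntegral.integral_sub (hgc.intervalIntegrable _ _)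
    ((by fun_prop : Continuous fun u => y₁ * Real.exp (A * u)).intervalIntegrable _ _)]
  have hb := intervalIntegral.norm_integral_le_of_norm_le_const (a := 0) (b := s) (C := M * s ^ 2)
    (f := fun u => g₁ u - y₁ * Real.exp (A * u)) (by
      intro u hu
      rw [Set.uIoc_of_le hs0] at hu
      refine (key u hu.1.le (hu.2.trans hsδ)).trans ?_
      have := hu.1.le
      have := hu.2
      gcongr)
  rw [Real.norm_eq_abs, sub_zero, abs_of_nonneg hs0] at hb
  refine hb.trans ?_
  have : 0 ≤ s ^ 3 := by positivity
  nlinarith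
end

section
/- Let α, β, θ > 0 satisfy 2αθ − β² > 0, and set J = θ − β²/(4α). Then J > 0, and for every y₂ > 0 and every s ≥ 0, J + (y₂ − J)·e^{−αs} > 0. Consequently, the second (squared-volatility) coordinate of the Ninomiya–Victoir approximation of the Heston model, which evolves under the maps y₂ ↦ J + (y₂ − J)e^{−αs} (s ≥ 0) and y₂ ↦ (βs/2 + √y₂)² (s ∈ ℝ), never becomes negative. -/
/-- Positivity of the squared-volatility coordinate in the Ninomiya–Victoir approximation of the
Heston model: under `2αθ − β² > 0`, `J = θ − β²/(4α) > 0`, the map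
`y₂ ↦ J + (y₂ − J)e^{−αs}` preserves positivity, and `y₂ ↦ (βs/2 + √y₂)²` is nonnegative. -/
theorem heston_volatility_stays_nonneg (α β θ : ℝ) (hα : 0 < α) (hβ : 0 < β) (hθ : 0 < θ)
    (h : 0 < 2 * α * θ - β ^ 2) (J : ℝ) (hJ : J = θ - β ^ 2 / (4 * α)) :
    0 < J ∧
      (∀ y₂ : ℝ, 0 < y₂ → ∀ s : ℝ, 0 ≤ s → 0 < J + (y₂ - J) * Real.exp (-α * s)) ∧
      (∀ y₂ : ℝ, ∀ s : ℝ, 0 ≤ (β * s / 2 + Real.sqrt y₂) ^ 2) := by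
  have hJpos : 0 < J := by
    rw [hJ, sub_pos, div_lt_iff₀ (by positivity)]
    nlinarith [mul_pos hα hθ]
  refine ⟨hJpos, ?_, fun y₂ s => sq_nonneg _⟩
  intro y₂ hy s hs
  have he : 0 < Real.exp (-α * s) := Real.exp_pos _
  have he1 : Real.exp (-α * s) ≤ 1 := by
    rw [Real.exp_le_one_iff]
    nlinarith [mul_nonneg hα.le hs]
  nlinarith [mul_pos hy he, mul_nonneg hJpos.le (sub_nonneg.mpr he1)]
end
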